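/- (Flux inequality; graph form of the necessary condition on λ.) Let D ⊆ ℝ² be a nonempty bounded open set whose boundary ∂D is a C¹ curve, and let u : ℝ² → ℝ be continuously differentiable on a neighborhood of the closure of D and satisfy the λ-soliton graph equation on D. Then |2λ·area(D) + ∫_D (1 + ‖∇u‖²)^{-1/2} dx| < ℋ¹(∂D), where area(D) is the Lebesgue measure of D and ℋ¹(∂D) is the 1-dimensional Hausdorff measure of the boundary of D. -/

import Mathlib

open MeasureTheory

noncomputable section

/-- The Euclidean plane. -/
abbrev E2 := EuclideanSpace ℝ (Fin 2)

/-- `W u x = √(1 + ‖∇u(x)‖²)`. -/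
noncomputable def W (u : E2 → ℝ) (x : E2) : ℝ := Real.sqrt (1 + ‖gradient u x‖ ^ 2)

/-- The divergence of a vector field `X : ℝ² → ℝ²`: `div X = ∂₁X₁ + ∂₂X₂`. -/
noncomputable def div2 (X : E2 → E2) (x : E2) : ℝ :=
  ∑ i : Fin 2, fderiv ℝ X x (EuclideanSpace.single i 1) i

/-- `u` satisfies the λ-soliton graph equation on the open set `D`: `u` is C² on `D` and
`div (∇u / W(u)) = 2λ + 1/W(u)` at every point of `D`. -/
def SatisfiesSolitonEq (lam : ℝ) (D : Set E2) (u : E2 → ℝ) : Prop :=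
  ContDiffOn ℝ 2 u D ∧
    ∀ x ∈ D, div2 (fun y => (W u y)⁻¹ • gradient u y) x = 2 * lam + (W u x)⁻¹

end

/-- `s` is a closed regular C¹ curve in the plane: the image of a periodic, regular,
C¹ parametrization which is injective on a fundamental period. -/
def IsC1ClosedCurve (s : Set E2) : Prop :=
  ∃ γ : ℝ → E2, ContDiff ℝ 1 γ ∧ Function.Periodic γ 1 ∧
    Set.InjOn γ (Set.Ico (0 : ℝ) 1) ∧ (∀ t : ℝ, deriv γ t ≠ 0) ∧ Set.range γ = s

open scoped RealInnerProductSpace Topology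

/-- The point with coordinates `(w.1, f w.1 + w.2)` in the orthonormal frame `b` based at `p`. -/
noncomputable def graphChart (p : E2) (b : OrthonormalBasis (Fin 2) ℝ E2) (f : ℝ → ℝ)
    (w : ℝ × ℝ) : E2 :=
  p + w.1 • b 0 + (f w.1 + w.2) • b 1

section graphChart

variable (p : E2) (b : OrthonormalBasis (Fin 2) ℝ E2) (f : ℝ → ℝ)

lemma inner_basis_zero_zero : ⟪b 0, b 0⟫ = 1 := by simp

lemma inner_basis_one_one : ⟪b 1, b 1⟫ = 1 := by simp

lemma inner_basis_zero_one : ⟪b 0, b 1⟫ = 0 := b.orthonormal.2 (by decide)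

lemma inner_basis_one_zero : ⟪b 1, b 0⟫ = 0 := b.orthonormal.2 (by decide)

lemma inner_basis_zero_graphChart_sub (w : ℝ × ℝ) : ⟪b 0, graphChart p b f w - p⟫ = w.1 := by
  have : graphChart p b f w - p = w.1 • b 0 + (f w.1 + w.2) • b 1 := by
    simp only [graphChart]; abel
  rw [this, inner_add_right, inner_smul_right, inner_smul_right, inner_basis_zero_zero,
    inner_basis_zero_one]
  simp

lemma inner_basis_one_graphChart_sub (w : ℝ × ℝ) :
    ⟪b 1, graphChart p b f w - p⟫ = f w.1 + w.2 := by
  have : graphChart p b f w - p = w.1 • b 0 + (f w.1 + w.2) • b 1 := by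
    simp only [graphChart]; abel
  rw [this, inner_add_right, inner_smul_right, inner_smul_right, inner_basis_one_one,
    inner_basis_one_zero]
  simp

lemma graphChart_injective : Function.Injective (graphChart p b f) := by
  intro w w' h
  have h0 : w.1 = w'.1 := by
    rw [← inner_basis_zero_graphChart_sub p b f w, h, inner_basis_zero_graphChart_sub]
  have h1 : f w.1 + w.2 = f w'.1 + w'.2 := by
    rw [← inner_basis_one_graphChart_sub p b f w, h, inner_basis_one_graphChart_sub]
  rw [h0] at h1
  exact Prod.ext h0 (add_left_cancel h1)

lemma graphChart_coords (z : E2) :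
    graphChart p b f (⟪b 0, z - p⟫, ⟪b 1, z - p⟫ - f ⟪b 0, z - p⟫) = z := by
  have h := b.sum_repr' (z - p)
  rw [Fin.sum_univ_two] at h
  simp only [graphChart, add_sub_cancel]
  rw [add_assoc, h]
  abel

variable {f}

lemma continuous_graphChart (hf : Continuous f) : Continuous (graphChart p b f) := by
  unfold graphChart
  fun_prop

lemma measurePreserving_graphChart (hf : Continuous f) :
    MeasurePreserving (graphChart p b f) volume volume := by
  have h1 : MeasurePreserving (fun w : ℝ × ℝ => (w.1, f w.1 + w.2))
      (volume.prod volume) (volume.prod volume) := by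
    refine (MeasurePreserving.id volume).skew_product (g := fun x y => f x + y) ?_ ?_
    · exact (by fun_prop : Continuous fun w : ℝ × ℝ => f w.1 + w.2).measurable
    · exact Filter.Eventually.of_forall fun x => (measurePreserving_add_left volume (f x)).map_eq
  have h2 := (volume_preserving_finTwoArrow ℝ).symm
  have h3 := PiLp.volume_preserving_toLp (Fin 2)
  have h4 := b.measurePreserving_repr_symm
  have h5 := measurePreserving_add_left (volume : Measure E2) p
  have h := h5.comp (h4.comp (h3.comp (h2.comp h1)))
  have key : graphChart p b f = (fun x => p + x) ∘ b.repr.symm ∘ WithLp.toLp 2 ∘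
      MeasurableEquiv.finTwoArrow.symm ∘ fun w : ℝ × ℝ => (w.1, f w.1 + w.2) := by
    ext1 w
    simp only [graphChart, Function.comp]
    rw [← OrthonormalBasis.sum_repr_symm]
    simp [Fin.sum_univ_two, MeasurableEquiv.finTwoArrow, add_assoc]
  rw [key]
  exact h

lemma measurableEmbedding_graphChart (hf : Continuous f) :
    MeasurableEmbedding (graphChart p b f) :=
  (continuous_graphChart p b hf).measurableEmbedding (graphChart_injective p b f)

lemma hasDerivAt_graphChart_fst {f' : ℝ} {x : ℝ} (hf : HasDerivAt f f' x) (s : ℝ) :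
    HasDerivAt (fun x => graphChart p b f (x, s)) (b 0 + f' • b 1) x := by
  unfold graphChart
  have h1 := ((hasDerivAt_id x).smul_const (b 0)).const_add p
  have h2 := (hf.add_const s).smul_const (b 1)
  simpa using h1.fun_add h2

lemma hasDerivAt_graphChart_snd (x s : ℝ) :
    HasDerivAt (fun s => graphChart p b f (x, s)) (b 1) s := by
  unfold graphChart
  have h2 := ((hasDerivAt_id s).const_add (f x)).smul_const (b 1)
  simpa using h2.const_add (p + x • b 0)

end graphChart

lemma div2_eq_sum_inner (X : E2 → E2) (x : E2) (b : OrthonormalBasis (Fin 2) ℝ E2) :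
    div2 X x = ⟪b 0, fderiv ℝ X x (b 0)⟫ + ⟪b 1, fderiv ℝ X x (b 1)⟫ := by
  have h1 := LinearMap.trace_eq_sum_inner (fderiv ℝ X x : E2 →ₗ[ℝ] E2) b
  have h2 := LinearMap.trace_eq_sum_inner (fderiv ℝ X x : E2 →ₗ[ℝ] E2)
    (EuclideanSpace.basisFun (Fin 2) ℝ)
  rw [h1] at h2
  simp only [Fin.sum_univ_two, ContinuousLinearMap.coe_coe, EuclideanSpace.basisFun_apply] at h2
  rw [h2, div2, Fin.sum_univ_two, EuclideanSpace.inner_single_left,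
    EuclideanSpace.inner_single_left]
  simp

section slice

variable {p : E2} {b : OrthonormalBasis (Fin 2) ℝ E2} {f f' : ℝ → ℝ}

/-- Flux of `V` through the translate by `s` in direction `b 1` of the graph of `f`. -/
noncomputable def sliceFlux (p : E2) (b : OrthonormalBasis (Fin 2) ℝ E2) (f f' : ℝ → ℝ)
    (V : E2 → E2) (s : ℝ) : ℝ :=
  ∫ x, ⟪b 1 - f' x • b 0, V (graphChart p b f (x, s))⟫

lemma continuous_of_hasDerivAt (hf : ∀ x, HasDerivAt f (f' x) x) : Continuous f :=
  continuous_iff_continuousAt.2 fun x => (hf x).continuousAt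

lemma continuous_sliceFlux (hf : ∀ x, HasDerivAt f (f' x) x) (hf' : Continuous f')
    {V : E2 → E2} (hV : Continuous V) {a : ℝ}
    (hsupp : ∀ x s, a ≤ |x| → V (graphChart p b f (x, s)) = 0) :
    Continuous (sliceFlux p b f f' V) := by
  have hΨ := continuous_graphChart p b (continuous_of_hasDerivAt hf)
  rw [← continuousOn_univ]
  refine continuousOn_integral_of_compact_support (isCompact_Icc (a := -a) (b := a)) ?_ ?_
  · exact (Continuous.inner (by fun_prop) (by fun_prop)).continuousOn
  · intro s x _ hx
    rw [hsupp, inner_zero_right]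
    by_contra! h
    exact hx ⟨(abs_lt.1 h).1.le, (abs_lt.1 h).2.le⟩

lemma hasDerivAt_sliceFlux (hf : ∀ x, HasDerivAt f (f' x) x) (hf' : Continuous f')
    {V : E2 → E2} {O : Set E2} (hO : IsOpen O) (hV : ContDiffOn ℝ 1 V O) {a : ℝ}
    (hsupp : ∀ x s, a ≤ |x| → V (graphChart p b f (x, s)) = 0)
    {s₁ s₂ : ℝ} (hmem : ∀ x, ∀ s ∈ Set.Ioo s₁ s₂, graphChart p b f (x, s) ∈ O)
    {s : ℝ} (hs : s ∈ Set.Ioo s₁ s₂) :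
    HasDerivAt (sliceFlux p b f f' V) (∫ x, div2 V (graphChart p b f (x, s))) s := by
  have hΨ := continuous_graphChart p b (continuous_of_hasDerivAt hf)
  have hdiff : ∀ x, ∀ t ∈ Set.Ioo s₁ s₂,
      HasFDerivAt V (fderiv ℝ V (graphChart p b f (x, t))) (graphChart p b f (x, t)) :=
    fun x t ht => ((hV.differentiableOn one_ne_zero).differentiableAt
      (hO.mem_nhds (hmem x t ht))).hasFDerivAt
  have hDV : ContinuousOn (fun w : ℝ × ℝ => fderiv ℝ V (graphChart p b f w))
      (Set.univ ×ˢ Set.Ioo s₁ s₂) :=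
    (hV.continuousOn_fderiv_of_isOpen hO le_rfl).comp hΨ.continuousOn
      fun w hw => hmem w.1 w.2 hw.2
  have hV' : ContinuousOn (fun w : ℝ × ℝ => V (graphChart p b f w))
      (Set.univ ×ˢ Set.Ioo s₁ s₂) :=
    hV.continuousOn.comp hΨ.continuousOn fun w hw => hmem w.1 w.2 hw.2
  have hline : ∀ t ∈ Set.Ioo s₁ s₂, Continuous fun x => fderiv ℝ V (graphChart p b f (x, t)) :=
    fun t ht => continuousOn_univ.1
      (hDV.comp (by fun_prop : Continuous fun x : ℝ => (x, t)).continuousOn fun x _ => ⟨trivial, ht⟩)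
  have hlineV : ∀ t ∈ Set.Ioo s₁ s₂, Continuous fun x => V (graphChart p b f (x, t)) :=
    fun t ht => continuousOn_univ.1
      (hV'.comp (by fun_prop : Continuous fun x : ℝ => (x, t)).continuousOn fun x _ => ⟨trivial, ht⟩)
  have hzero : ∀ x, a ≤ |x| → ∀ t ∈ Set.Ioo s₁ s₂,
      fderiv ℝ V (graphChart p b f (x, t)) (b 1) = 0 := by
    intro x hx t ht
    have h1 := (hdiff x t ht).comp_hasDerivAt t (hasDerivAt_graphChart_snd p b (f := f) x t)
    have h2 : (V ∘ fun t => graphChart p b f (x, t)) = fun _ => 0 :=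
      funext fun t => hsupp x t hx
    rw [h2] at h1
    exact h1.unique (hasDerivAt_const t 0)
  have hcs : ∀ t, HasCompactSupport fun x => V (graphChart p b f (x, t)) := fun t =>
    HasCompactSupport.intro (isCompact_Icc (a := -a) (b := a)) fun x hx =>
      hsupp x t (by
        by_contra! h
        exact hx ⟨(abs_lt.1 h).1.le, (abs_lt.1 h).2.le⟩)
  obtain ⟨ε, hε, hball⟩ := Metric.nhds_basis_closedBall.mem_iff.1 (isOpen_Ioo.mem_nhds hs)
  obtain ⟨C, hC⟩ := ((isCompact_Icc (a := -a) (b := a)).prod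
      (isCompact_closedBall s ε)).exists_bound_of_continuousOn
    (f := fun w : ℝ × ℝ =>
      ⟪b 1 - f' w.1 • b 0, fderiv ℝ V (graphChart p b f w) (b 1)⟫) (by
        have : ContinuousOn (fun w : ℝ × ℝ => fderiv ℝ V (graphChart p b f w) (b 1))
            (Set.Icc (-a) a ×ˢ Metric.closedBall s ε) :=
          (hDV.mono (Set.prod_mono (Set.subset_univ _) hball)).clm_apply continuousOn_const
        exact ContinuousOn.inner (𝕜 := ℝ) (by fun_prop) this)
  have hderiv := hasDerivAt_integral_of_dominated_loc_of_deriv_le (μ := (volume : Measure ℝ))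
    (F := fun t x => ⟪b 1 - f' x • b 0, V (graphChart p b f (x, t))⟫)
    (F' := fun t x => ⟪b 1 - f' x • b 0, fderiv ℝ V (graphChart p b f (x, t)) (b 1)⟫)
    (x₀ := s) (bound := (Set.Icc (-a) a).indicator fun _ => C)
    (Metric.closedBall_mem_nhds s hε)
    (Filter.eventually_of_mem (isOpen_Ioo.mem_nhds hs) fun t ht =>
      (Continuous.inner (by fun_prop) (hlineV t ht)).aestronglyMeasurable)
    ((Continuous.inner (by fun_prop) (hlineV s hs)).integrable_of_hasCompactSupport
      ((hcs s).mono' (by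
        refine Set.Subset.trans (fun x hx => ?_) subset_closure
        simp only [Function.mem_support] at hx ⊢
        exact fun h => hx (by rw [h, inner_zero_right]))))
    (Continuous.inner (by fun_prop)
      ((hline s hs).clm_apply continuous_const)).aestronglyMeasurable
    (Filter.Eventually.of_forall fun x t ht => by
      by_cases hx : x ∈ Set.Icc (-a) a
      · rw [Set.indicator_of_mem hx]
        exact hC (x, t) ⟨hx, ht⟩
      · rw [Set.indicator_of_notMem hx, hzero x _ t (hball ht), inner_zero_right, norm_zero]
        by_contra! h
        exact hx ⟨(abs_lt.1 h).1.le, (abs_lt.1 h).2.le⟩)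
    ((integrable_indicator_iff measurableSet_Icc).2
      (integrableOn_const (by simp)))
    (Filter.Eventually.of_forall fun x t ht => by
      have h1 := (hdiff x t (hball ht)).comp_hasDerivAt t
        (hasDerivAt_graphChart_snd p b (f := f) x t)
      exact ((innerSL ℝ (b 1 - f' x • b 0)).hasFDerivAt.comp_hasDerivAt t h1))
  have hx : ∀ x, HasDerivAt (fun x => ⟪b 0, V (graphChart p b f (x, s))⟫)
      ⟪b 0, fderiv ℝ V (graphChart p b f (x, s)) (b 0 + f' x • b 1)⟫ x := fun x => by
    have h1 := (hdiff x s hs).comp_hasDerivAt x (hasDerivAt_graphChart_fst p b (hf x) s)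
    exact ((innerSL ℝ (b 0)).hasFDerivAt.comp_hasDerivAt x h1)
  have hcs0 : HasCompactSupport fun x => ⟪b 0, V (graphChart p b f (x, s))⟫ :=
    (hcs s).mono' (by
      refine Set.Subset.trans (fun x hx => ?_) subset_closure
      simp only [Function.mem_support] at hx ⊢
      exact fun h => hx (by rw [h, inner_zero_right]))
  have hint : Integrable
      fun x => ⟪b 0, fderiv ℝ V (graphChart p b f (x, s)) (b 0 + f' x • b 1)⟫ := by
    refine Continuous.integrable_of_hasCompactSupport
      (Continuous.inner continuous_const ((hline s hs).clm_apply (by fun_prop))) ?_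
    rw [← funext fun x => (hx x).deriv]
    exact hcs0.deriv
  have h0 := integral_eq_zero_of_hasDerivAt_of_integrable hx hint
    ((Continuous.inner continuous_const (hlineV s hs)).integrable_of_hasCompactSupport hcs0)
  suffices key : ∫ x, div2 V (graphChart p b f (x, s)) =
      ∫ x, ⟪b 1 - f' x • b 0, fderiv ℝ V (graphChart p b f (x, s)) (b 1)⟫ by
    rw [key]
    exact hderiv.2
  rw [← add_zero (∫ x, ⟪b 1 - f' x • b 0, fderiv ℝ V (graphChart p b f (x, s)) (b 1)⟫), ← h0,
    ← integral_add hderiv.1 hint]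
  congr 1 with x
  rw [div2_eq_sum_inner _ _ b]
  simp only [map_add, map_smul, inner_add_right, inner_sub_left, inner_smul_left,
    inner_smul_right, RCLike.conj_to_real]
  ring

end slice

lemma div2_eq_zero_of_notMem_tsupport {V : E2 → E2} {x : E2} (hx : x ∉ tsupport V) :
    div2 V x = 0 := by
  have : fderiv ℝ V x = 0 := by
    by_contra h
    exact hx (support_fderiv_subset ℝ h)
  simp [div2, this]

lemma indicator_div2_eq_zero_of_notMem_tsupport {V : E2 → E2} (D : Set E2) {x : E2}
    (hx : x ∉ tsupport V) : D.indicator (div2 V) x = 0 :=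
  Set.indicator_apply_eq_zero.2 fun _ => div2_eq_zero_of_notMem_tsupport hx

lemma contDiffOn_union_compl_tsupport {V : E2 → E2} {D : Set E2} (hD : IsOpen D)
    (hV : ContDiffOn ℝ 1 V D) : ContDiffOn ℝ 1 V (D ∪ (tsupport V)ᶜ) := by
  rintro x (hx | hx)
  · exact (hV.contDiffAt (hD.mem_nhds hx)).contDiffWithinAt
  · exact (contDiffAt_const (c := (0 : E2))).congr_of_eventuallyEq
      (notMem_tsupport_iff_eventuallyEq.1 hx) |>.contDiffWithinAt

section box

variable {p : E2} {b : OrthonormalBasis (Fin 2) ℝ E2} {f f' : ℝ → ℝ} {D : Set E2} {a h : ℝ}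
  {V : E2 → E2}

/-- Flux through the boundary of the part of `D` lying in a strip of the chart that does not
meet `∂D`: the strip is either contained in `D` or disjoint from it. -/
lemma exists_integral_strip_eq (hf : ∀ x, HasDerivAt f (f' x) x) (hf' : Continuous f')
    (hD : IsOpen D) (hV : Continuous V) (hVD : ContDiffOn ℝ 1 V D)
    (hsupp : tsupport V ⊆ graphChart p b f '' (Set.Ioo (-a) a ×ˢ Set.Ioo (-h) h))
    (hint : Integrable fun s => ∫ x, D.indicator (div2 V) (graphChart p b f (x, s)))
    {s₁ s₂ : ℝ} (hs : s₁ ≤ s₂)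
    (hfr : ∀ x s, |x| < a → s ∈ Set.Ioo s₁ s₂ → graphChart p b f (x, s) ∉ frontier D) :
    ∃ c : ℝ, (c = 0 ∨ c = 1) ∧
      ∫ s in s₁..s₂, ∫ x, D.indicator (div2 V) (graphChart p b f (x, s)) =
        c * (sliceFlux p b f f' V s₂ - sliceFlux p b f f' V s₁) := by
  have hΨ := continuous_graphChart p b (continuous_of_hasDerivAt hf)
  have hnot : ∀ x s, ¬ |x| < a → graphChart p b f (x, s) ∉ tsupport V := by
    intro x s hx hmem
    obtain ⟨w, hw, hww⟩ := hsupp hmem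
    rw [graphChart_injective p b f hww] at hw
    exact hx (abs_lt.2 hw.1)
  have hVzero : ∀ x s, a ≤ |x| → V (graphChart p b f (x, s)) = 0 := fun x s hx =>
    image_eq_zero_of_notMem_tsupport (hnot x s hx.not_gt)
  have hpre : IsPreconnected (graphChart p b f '' (Set.Ioo (-a) a ×ˢ Set.Ioo s₁ s₂)) :=
    (isPreconnected_Ioo.prod isPreconnected_Ioo).image _ hΨ.continuousOn
  have hdisj : ¬ (graphChart p b f '' (Set.Ioo (-a) a ×ˢ Set.Ioo s₁ s₂) ∩
      frontier D).Nonempty := by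
    rintro ⟨_, ⟨w, hw, rfl⟩, hmem⟩
    exact hfr w.1 w.2 (abs_lt.2 hw.1) hw.2 hmem
  by_cases hne : (graphChart p b f '' (Set.Ioo (-a) a ×ˢ Set.Ioo s₁ s₂) ∩ D).Nonempty
  · have hsub : ∀ x s, |x| < a → s ∈ Set.Ioo s₁ s₂ → graphChart p b f (x, s) ∈ D := by
      intro x s hx hs'
      have hcover : ∀ z ∈ graphChart p b f '' (Set.Ioo (-a) a ×ˢ Set.Ioo s₁ s₂),
          z ∈ D ∨ z ∈ (closure D)ᶜ := fun z hz => by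
        by_contra! hcon
        refine hdisj ⟨z, hz, ?_⟩
        rw [hD.frontier_eq]
        exact ⟨not_not.1 hcon.2, hcon.1⟩
      have hz := Set.mem_image_of_mem (graphChart p b f)
        (show (x, s) ∈ Set.Ioo (-a) a ×ˢ Set.Ioo s₁ s₂ from ⟨abs_lt.1 hx, hs'⟩)
      refine (hcover _ hz).resolve_right fun hcon => ?_
      obtain ⟨z, -, hzD, hzD'⟩ := hpre D (closure D)ᶜ hD isClosed_closure.isOpen_compl
        hcover hne ⟨_, hz, hcon⟩
      exact hzD' (subset_closure hzD)
    refine ⟨1, Or.inr rfl, ?_⟩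
    rw [one_mul]
    refine intervalIntegral.integral_eq_sub_of_hasDerivAt_of_le hs
      (continuous_sliceFlux hf hf' hV hVzero).continuousOn (fun s hs' => ?_)
      hint.intervalIntegrable
    have heq : ∫ x, D.indicator (div2 V) (graphChart p b f (x, s)) =
        ∫ x, div2 V (graphChart p b f (x, s)) := by
      congr 1 with x
      by_cases hx : |x| < a
      · rw [Set.indicator_of_mem (hsub x s hx hs')]
      · rw [indicator_div2_eq_zero_of_notMem_tsupport D (hnot x s hx),
          div2_eq_zero_of_notMem_tsupport (hnot x s hx)]
    rw [heq]
    refine hasDerivAt_sliceFlux hf hf'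
      (hD.union (isClosed_tsupport V).isOpen_compl) (contDiffOn_union_compl_tsupport hD hVD)
      hVzero (fun x t ht => ?_) hs'
    by_cases hx : |x| < a
    · exact Or.inl (hsub x t hx ht)
    · exact Or.inr (hnot x t hx)
  · refine ⟨0, Or.inl rfl, ?_⟩
    rw [zero_mul, ← sub_self (0 : ℝ)]
    refine intervalIntegral.integral_eq_sub_of_hasDerivAt_of_le (f := fun _ => (0 : ℝ)) hs
      continuousOn_const (fun s hs' => ?_) hint.intervalIntegrable
    have heq : ∫ x, D.indicator (div2 V) (graphChart p b f (x, s)) = 0 := by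
      rw [← integral_zero ℝ ℝ]
      congr 1 with x
      refine Set.indicator_apply_eq_zero.2 fun hmem =>
        div2_eq_zero_of_notMem_tsupport (hnot x s fun hx => hne ?_)
      exact ⟨_, Set.mem_image_of_mem _ ⟨abs_lt.1 hx, hs'⟩, hmem⟩
    rw [heq]
    exact hasDerivAt_const s 0

lemma abs_integral_div2_le_abs_sliceFlux (hf : ∀ x, HasDerivAt f (f' x) x)
    (hf' : Continuous f') (hD : IsOpen D) (hV : Continuous V) (hVD : ContDiffOn ℝ 1 V D)
    (hh : 0 < h)
    (hsupp : tsupport V ⊆ graphChart p b f '' (Set.Ioo (-a) a ×ˢ Set.Ioo (-h) h))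
    (hint : IntegrableOn (div2 V) D)
    (hfr : ∀ x s, |x| < a → |s| < h → graphChart p b f (x, s) ∈ frontier D → s = 0) :
    |∫ z in D, div2 V z| ≤ |sliceFlux p b f f' V 0| := by
  have hfc := continuous_of_hasDerivAt hf
  have hmp := measurePreserving_graphChart p b hfc
  have hemb := measurableEmbedding_graphChart p b hfc
  have hnot : ∀ x s, ¬ |s| < h → graphChart p b f (x, s) ∉ tsupport V := by
    intro x s hs hmem
    obtain ⟨w, hw, hww⟩ := hsupp hmem
    rw [graphChart_injective p b f hww] at hw
    exact hs (abs_lt.2 hw.2)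
  have hint' : Integrable (fun w => D.indicator (div2 V) (graphChart p b f w))
      ((volume : Measure ℝ).prod volume) :=
    (hmp.integrable_comp_emb hemb).2 ((integrable_indicator_iff hD.measurableSet).2 hint)
  have hg := hint'.integral_prod_right
  have h1 : ∫ z in D, div2 V z =
      ∫ s, ∫ x, D.indicator (div2 V) (graphChart p b f (x, s)) := by
    rw [← integral_indicator hD.measurableSet, ← hmp.integral_comp hemb]
    exact integral_prod_symm _ hint'
  have h2 : ∫ s in (-h)..h, ∫ x, D.indicator (div2 V) (graphChart p b f (x, s)) =
      ∫ s, ∫ x, D.indicator (div2 V) (graphChart p b f (x, s)) := by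
    refine intervalIntegral.integral_eq_integral_of_support_subset fun s hs => ?_
    by_contra hcon
    refine hs ?_
    have hs' : ¬ |s| < h := fun hlt => hcon ⟨(abs_lt.1 hlt).1, (abs_lt.1 hlt).2.le⟩
    simp only [indicator_div2_eq_zero_of_notMem_tsupport D (hnot _ s hs'), integral_zero]
  have hA : ∀ s, ¬ |s| < h → sliceFlux p b f f' V s = 0 := by
    intro s hs
    simp only [sliceFlux, image_eq_zero_of_notMem_tsupport (hnot _ s hs), inner_zero_right,
      integral_zero]
  obtain ⟨c, hc, hcs⟩ := exists_integral_strip_eq hf hf' hD hV hVD hsupp hg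
    (s₁ := -h) (s₂ := 0) (by linarith) (fun x s hx hs hmem =>
      hs.2.ne (hfr x s hx (abs_lt.2 ⟨hs.1, hs.2.trans hh⟩) hmem))
  obtain ⟨d, hd, hds⟩ := exists_integral_strip_eq hf hf' hD hV hVD hsupp hg
    (s₁ := 0) (s₂ := h) hh.le (fun x s hx hs hmem =>
      hs.1.ne' (hfr x s hx (abs_lt.2 ⟨by linarith [hs.1], hs.2⟩) hmem))
  rw [h1, ← h2, ← intervalIntegral.integral_add_adjacent_intervals
    hg.intervalIntegrable hg.intervalIntegrable (b := 0), hcs, hds,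
    hA (-h) (by rw [abs_neg, abs_of_pos hh]; exact lt_irrefl h),
    hA h (by rw [abs_of_pos hh]; exact lt_irrefl h)]
  rcases hc with rfl | rfl <;> rcases hd with rfl | rfl <;> simp

end box

lemma lipschitzWith_inner_sub (p e : E2) (he : ‖e‖ = 1) :
    LipschitzWith 1 fun z : E2 => ⟪e, z - p⟫ := by
  refine LipschitzWith.of_dist_le_mul fun x y => ?_
  have h : ⟪e, x - p⟫ - ⟪e, y - p⟫ = ⟪e, x - y⟫ := by
    rw [← inner_sub_right, sub_sub_sub_cancel_right]
  rw [Real.dist_eq, h, dist_eq_norm, NNReal.coe_one, ← he]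
  exact abs_real_inner_le_norm _ _

/-- Projection to the tangent does not increase `μH[1]`. -/
lemma integral_graphChart_le {p : E2} {b : OrthonormalBasis (Fin 2) ℝ E2} {f : ℝ → ℝ}
    (hf : Continuous f) {F : Set E2} (hF : IsClosed F) {a h : ℝ} (hh : 0 < h) {φ : E2 → ℝ}
    (hφ : Continuous φ) (hφ0 : ∀ z, 0 ≤ φ z)
    (hsupp : tsupport φ ⊆ graphChart p b f '' (Set.Ioo (-a) a ×ˢ Set.Ioo (-h) h))
    (hint : IntegrableOn φ F μH[1])
    (hFr : ∀ x s, |x| < a → |s| < h → (graphChart p b f (x, s) ∈ F ↔ s = 0)) :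
    ∫ x, φ (graphChart p b f (x, 0)) ≤ ∫ z in F, φ z ∂μH[1] := by
  have hΨ := continuous_graphChart p b hf
  set N := graphChart p b f '' (Set.Ioo (-a) a ×ˢ Set.Ioo (-h) h) with hN
  have hNm : MeasurableSet N := (measurableEmbedding_graphChart p b hf).measurableSet_image.2
    (measurableSet_Ioo.prod measurableSet_Ioo)
  have hπ := lipschitzWith_inner_sub p (b 0) (b.orthonormal.1 0)
  have hψ : Continuous fun x => graphChart p b f (x, 0) := by fun_prop
  have hmeas : Measurable fun x => ENNReal.ofReal (φ (graphChart p b f (x, 0))) :=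
    (hφ.comp hψ).measurable.ennreal_ofReal
  have hle : (volume : Measure ℝ).restrict (Set.Ioo (-a) a) ≤
      (((μH[1] : Measure E2).restrict (F ∩ N)).map fun z => ⟪b 0, z - p⟫) := by
    refine Measure.le_iff.2 fun A hA => ?_
    rw [Measure.restrict_apply hA, Measure.map_apply hπ.continuous.measurable hA,
      Measure.restrict_apply (hπ.continuous.measurable hA), ← hausdorffMeasure_real]
    calc μH[1] (A ∩ Set.Ioo (-a) a)
        ≤ μH[1] ((fun z => ⟪b 0, z - p⟫) ''
            ((fun z : E2 => ⟪b 0, z - p⟫) ⁻¹' A ∩ (F ∩ N))) := by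
          refine measure_mono fun x hx => ?_
          have hxa : |x| < a := abs_lt.2 hx.2
          refine ⟨graphChart p b f (x, 0), ⟨?_, ?_, ?_⟩, ?_⟩
          · rw [Set.mem_preimage, inner_basis_zero_graphChart_sub]
            exact hx.1
          · exact (hFr x 0 hxa (by simpa using hh)).2 rfl
          · exact Set.mem_image_of_mem _ ⟨hx.2, by simpa using hh⟩
          · exact inner_basis_zero_graphChart_sub p b f (x, 0)
      _ ≤ _ := by
          simpa using hπ.hausdorffMeasure_image_le zero_le_one
            ((fun z : E2 => ⟪b 0, z - p⟫) ⁻¹' A ∩ (F ∩ N))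
  have hlin : ∫⁻ x, ENNReal.ofReal (φ (graphChart p b f (x, 0))) ≤
      ∫⁻ z in F, ENNReal.ofReal (φ z) ∂μH[1] := by
    calc ∫⁻ x, ENNReal.ofReal (φ (graphChart p b f (x, 0)))
        = ∫⁻ x in Set.Ioo (-a) a, ENNReal.ofReal (φ (graphChart p b f (x, 0))) := by
          refine (setLIntegral_eq_of_support_subset fun x hx => ?_).symm
          by_contra hcon
          refine hx ?_
          have : graphChart p b f (x, 0) ∉ tsupport φ := fun hmem => by
            obtain ⟨w, hw, hww⟩ := hsupp hmem
            rw [graphChart_injective p b f hww] at hw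
            exact hcon hw.1
          simp [image_eq_zero_of_notMem_tsupport this]
      _ ≤ ∫⁻ x, ENNReal.ofReal (φ (graphChart p b f (x, 0)))
            ∂(((μH[1] : Measure E2).restrict (F ∩ N)).map fun z => ⟪b 0, z - p⟫) :=
          lintegral_mono' hle le_rfl
      _ = ∫⁻ z in F ∩ N, ENNReal.ofReal (φ (graphChart p b f (⟪b 0, z - p⟫, 0))) ∂μH[1] :=
          lintegral_map hmeas hπ.continuous.measurable
      _ = ∫⁻ z in F ∩ N, ENNReal.ofReal (φ z) ∂μH[1] := by
          refine setLIntegral_congr_fun (hF.measurableSet.inter hNm) ?_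
          rintro _ ⟨hzF, w, hw, rfl⟩
          have hw2 : w.2 = 0 := (hFr w.1 w.2 (abs_lt.2 hw.1) (abs_lt.2 hw.2)).1 hzF
          simp only [inner_basis_zero_graphChart_sub, ← hw2]
      _ ≤ ∫⁻ z in F, ENNReal.ofReal (φ z) ∂μH[1] := lintegral_mono_set Set.inter_subset_left
  rw [integral_eq_lintegral_of_nonneg_ae (Filter.Eventually.of_forall fun x => hφ0 _)
      (hφ.comp hψ).aestronglyMeasurable,
    integral_eq_lintegral_of_nonneg_ae (Filter.Eventually.of_forall fun z => hφ0 z)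
      hφ.aestronglyMeasurable]
  exact ENNReal.toReal_mono (Integrable.lintegral_lt_top hint).ne hlin

lemma div2_smul {φ : E2 → ℝ} {X : E2 → E2} {z : E2} (hφ : DifferentiableAt ℝ φ z)
    (hX : DifferentiableAt ℝ X z) :
    div2 (fun z => φ z • X z) z = φ z * div2 X z + fderiv ℝ φ z (X z) := by
  have hsum : X z = ∑ i, X z i • EuclideanSpace.single i (1 : ℝ) := by
    ext j
    fin_cases j <;> simp [Fin.sum_univ_two]
  have h : fderiv ℝ φ z (X z) = ∑ i, X z i * fderiv ℝ φ z (EuclideanSpace.single i 1) := by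
    conv_lhs => rw [hsum]
    simp [map_smul]
  rw [h]
  simp only [div2, fderiv_fun_smul hφ hX, Fin.sum_univ_two]
  simp
  ring

lemma continuous_of_continuousOn_of_forall_notMem {Y : Type*} [NormedAddCommGroup Y]
    {g : E2 → Y} {φ : E2 → ℝ} {U : Set E2} (hU : IsOpen U) (hg : ContinuousOn g U)
    (hφ : tsupport φ ⊆ U) (h0 : ∀ z ∉ tsupport φ, g z = 0) : Continuous g := by
  refine continuous_iff_continuousAt.2 fun z => ?_
  by_cases hz : z ∈ tsupport φ
  · exact hg.continuousAt (hU.mem_nhds (hφ hz))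
  · refine (continuousAt_const (y := (0 : Y))).congr ?_
    filter_upwards [(isClosed_tsupport φ).isOpen_compl.mem_nhds hz] with y hy
    exact (h0 y hy).symm

lemma integrableOn_div2_smul {D U : Set E2} (hD : IsOpen D) (hU : IsOpen U) {X : E2 → E2}
    (hXU : ContinuousOn X U) (hXD : DifferentiableOn ℝ X D) (hint : IntegrableOn (div2 X) D)
    {φ : E2 → ℝ} (hφ : ContDiff ℝ 1 φ) (hφc : HasCompactSupport φ) (hsupp : tsupport φ ⊆ U) :
    IntegrableOn (fun z => φ z * div2 X z) D ∧ IntegrableOn (fun z => fderiv ℝ φ z (X z)) D ∧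
    IntegrableOn (div2 fun z => φ z • X z) D ∧
      ∫ z in D, div2 (fun z => φ z • X z) z =
        (∫ z in D, φ z * div2 X z) + ∫ z in D, fderiv ℝ φ z (X z) := by
  obtain ⟨C, hC⟩ := hφ.continuous.bounded_above_of_compact_support hφc
  have h1 : IntegrableOn (fun z => φ z * div2 X z) D :=
    hint.bdd_mul hφ.continuous.aestronglyMeasurable (Filter.Eventually.of_forall hC)
  have hz : ∀ z ∉ tsupport φ, fderiv ℝ φ z (X z) = 0 := fun z hz => by
    have : fderiv ℝ φ z = 0 := by
      by_contra h
      exact hz (support_fderiv_subset ℝ h)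
    simp [this]
  have h2c : Continuous fun z => fderiv ℝ φ z (X z) :=
    continuous_of_continuousOn_of_forall_notMem hU
      ((hφ.continuous_fderiv one_ne_zero).continuousOn.clm_apply hXU) hsupp hz
  have h2 : IntegrableOn (fun z => fderiv ℝ φ z (X z)) D :=
    (h2c.integrable_of_hasCompactSupport (HasCompactSupport.intro hφc hz)).integrableOn
  have heq : Set.EqOn (div2 fun z => φ z • X z)
      (fun z => φ z * div2 X z + fderiv ℝ φ z (X z)) D := fun z hz =>
    div2_smul (hφ.differentiable one_ne_zero z) (hXD.differentiableAt (hD.mem_nhds hz))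
  refine ⟨h1, h2, (h1.add h2).congr_fun heq.symm hD.measurableSet, ?_⟩
  rw [setIntegral_congr_fun hD.measurableSet heq, integral_add h1 h2]

/-- Local flux estimate near a boundary point around which `∂D` is a graph. -/
lemma abs_integral_div2_smul_le {p : E2} {b : OrthonormalBasis (Fin 2) ℝ E2} {f f' : ℝ → ℝ}
    {D U : Set E2} {a h δ q : ℝ} {X : E2 → E2} {φ : E2 → ℝ}
    (hf : ∀ x, HasDerivAt f (f' x) x) (hf' : Continuous f') (hδ : ∀ x, |f' x| ≤ δ)
    (hD : IsOpen D) (hU : IsOpen U) (hXU : ContinuousOn X U) (hXD : ContDiffOn ℝ 1 X D)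
    (hint : IntegrableOn (div2 X) D) (hq0 : 0 ≤ q) (hq : ∀ z ∈ frontier D, ‖X z‖ ≤ q)
    (hfin : μH[1] (frontier D) ≠ ⊤) (hh : 0 < h)
    (hFr : ∀ x s, |x| < a → |s| < h → (graphChart p b f (x, s) ∈ frontier D ↔ s = 0))
    (hφ : ContDiff ℝ 1 φ) (hφc : HasCompactSupport φ) (hφ0 : ∀ z, 0 ≤ φ z)
    (hsuppU : tsupport φ ⊆ U)
    (hsupp : tsupport φ ⊆ graphChart p b f '' (Set.Ioo (-a) a ×ˢ Set.Ioo (-h) h)) :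
    |∫ z in D, div2 (fun z => φ z • X z) z| ≤
      (1 + δ) * q * ∫ z in frontier D, φ z ∂μH[1] := by
  have hfc := continuous_of_hasDerivAt hf
  have hψ : Continuous fun x => graphChart p b f (x, 0) := by
    have := continuous_graphChart p b hfc
    fun_prop
  have hsub : tsupport (fun z => φ z • X z) ⊆ tsupport φ := tsupport_smul_subset_left φ X
  have hVc : Continuous fun z => φ z • X z :=
    continuous_of_continuousOn_of_forall_notMem hU (hφ.continuous.continuousOn.smul hXU) hsuppU
      fun z hz => by rw [image_eq_zero_of_notMem_tsupport hz, zero_smul]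
  have hout : ∀ x, ¬ |x| < a → φ (graphChart p b f (x, 0)) = 0 := fun x hx =>
    image_eq_zero_of_notMem_tsupport fun hmem => by
      obtain ⟨w, hw, hww⟩ := hsupp hmem
      rw [graphChart_injective p b f hww] at hw
      exact hx (abs_lt.2 hw.1)
  have h1 := abs_integral_div2_le_abs_sliceFlux hf hf' hD hVc (hφ.contDiffOn.smul hXD) hh
    (hsub.trans hsupp)
    (integrableOn_div2_smul hD hU hXU (hXD.differentiableOn one_ne_zero) hint hφ hφc
      hsuppU).2.2.1
    (fun x s hx hs => (hFr x s hx hs).1)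
  have hδ0 : 0 ≤ δ := (abs_nonneg _).trans (hδ 0)
  have hIφ : Integrable fun x => φ (graphChart p b f (x, 0)) :=
    (hφ.continuous.comp hψ).integrable_of_hasCompactSupport
      (HasCompactSupport.intro (isCompact_Icc (a := -a) (b := a)) fun x hx =>
        hout x fun hlt => hx ⟨(abs_lt.1 hlt).1.le, (abs_lt.1 hlt).2.le⟩)
  obtain ⟨C, hC⟩ := hφ.continuous.bounded_above_of_compact_support hφc
  have hIF : IntegrableOn φ (frontier D) μH[1] :=
    Measure.integrableOn_of_bounded hfin hφ.continuous.aestronglyMeasurable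
      (Filter.Eventually.of_forall hC)
  have h2 := integral_graphChart_le hfc isClosed_frontier hh hφ.continuous hφ0 hsupp hIF hFr
  have h3 : |sliceFlux p b f f' (fun z => φ z • X z) 0| ≤
      ∫ x, (1 + δ) * q * φ (graphChart p b f (x, 0)) := by
    rw [sliceFlux, ← Real.norm_eq_abs]
    refine norm_integral_le_of_norm_le (hIφ.const_mul _) (Filter.Eventually.of_forall fun x => ?_)
    by_cases hx : |x| < a
    · have hXq := hq _ ((hFr x 0 hx (by simpa using hh)).2 rfl)
      have hn : ‖b 1 - f' x • b 0‖ ≤ 1 + δ := by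
        refine (norm_sub_le _ _).trans ?_
        rw [norm_smul, b.orthonormal.1, b.orthonormal.1, mul_one]
        exact add_le_add_right (hδ x) 1
      refine (abs_real_inner_le_norm _ _).trans ?_
      rw [norm_smul, Real.norm_of_nonneg (hφ0 _), mul_assoc, mul_comm q]
      have hφx := hφ0 (graphChart p b f (x, 0))
      gcongr
    · simp [hout x hx]
  rw [integral_const_mul] at h3
  exact h1.trans (h3.trans (by gcongr))

lemma integral_div2_eq_zero {V : E2 → E2} (hV : ContDiff ℝ 1 V) (hc : HasCompactSupport V) :
    ∫ z, div2 V z = 0 := by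
  have hint : ∀ v, Integrable fun z => fderiv ℝ V z v := fun v =>
    ((hV.continuous_fderiv one_ne_zero).clm_apply continuous_const).integrable_of_hasCompactSupport
      (hc.fderiv_apply (𝕜 := ℝ) v)
  have h0 : ∀ v, ∫ z, fderiv ℝ V z v = 0 := fun v => by
    have h := integral_smul_fderiv_eq_neg_fderiv_smul_of_integrable (μ := (volume : Measure E2))
      (f := fun _ => (1 : ℝ)) (g := V) (v := v) (by simp) (by simpa using hint v)
      (by simpa using hV.continuous.integrable_of_hasCompactSupport hc)
      (fun z _ => differentiableAt_const _) (fun z _ => hV.differentiable one_ne_zero z)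
    simpa using h
  have hint' : ∀ i : Fin 2,
      Integrable fun z => fderiv ℝ V z (EuclideanSpace.single i 1) i := fun i =>
    (EuclideanSpace.proj (𝕜 := ℝ) i).integrable_comp (hint (EuclideanSpace.single i 1))
  have hi : ∀ i : Fin 2,
      ∫ z, fderiv ℝ V z (EuclideanSpace.single i 1) i = 0 := fun i => by
    have h := (EuclideanSpace.proj (𝕜 := ℝ) i).integral_comp_comm
      (hint (EuclideanSpace.single i 1))
    rw [h0] at h
    simpa using h
  simp only [div2]
  rw [integral_finsetSum _ fun i _ => hint' i]
  exact Finset.sum_eq_zero fun i _ => hi i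

lemma setIntegral_div2_smul_eq_zero {D : Set E2} (hD : IsOpen D) {X : E2 → E2}
    (hX : ContDiffOn ℝ 1 X D) {φ : E2 → ℝ} (hφ : ContDiff ℝ 1 φ) (hφc : HasCompactSupport φ)
    (hsupp : tsupport φ ⊆ D) : ∫ z in D, div2 (fun z => φ z • X z) z = 0 := by
  have hsub : tsupport (fun z => φ z • X z) ⊆ tsupport φ := tsupport_smul_subset_left φ X
  have hV : ContDiff ℝ 1 fun z => φ z • X z := by
    have h := contDiffOn_union_compl_tsupport hD (hφ.contDiffOn.smul hX)
    rw [← contDiffOn_univ]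
    refine h.mono fun z _ => ?_
    by_cases hz : z ∈ D
    · exact Or.inl hz
    · exact Or.inr fun hmem => hz (hsupp (hsub hmem))
  rw [setIntegral_eq_integral_of_forall_compl_eq_zero fun z hz =>
    div2_eq_zero_of_notMem_tsupport fun hmem => hz (hsupp (hsub hmem))]
  exact integral_div2_eq_zero hV hφc.smul_right

/-- A local flux estimate at every boundary point gives a global one, by a partition of unity. -/
lemma abs_integral_div2_le_of_local {D U : Set E2} (hD : IsOpen D)
    (hDb : Bornology.IsBounded D) (hU : IsOpen U) (hDU : closure D ⊆ U) {X : E2 → E2}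
    (hXU : ContinuousOn X U) (hXD : ContDiffOn ℝ 1 X D) (hint : IntegrableOn (div2 X) D)
    (hfin : μH[1] (frontier D) ≠ ⊤) {C : ℝ} (hC : 0 ≤ C)
    (hloc : ∀ p ∈ frontier D, ∃ N : Set E2, IsOpen N ∧ p ∈ N ∧
      ∀ φ : E2 → ℝ, ContDiff ℝ 1 φ → HasCompactSupport φ → (∀ z, 0 ≤ φ z) →
        tsupport φ ⊆ U → tsupport φ ⊆ N →
        |∫ z in D, div2 (fun z => φ z • X z) z| ≤ C * ∫ z in frontier D, φ z ∂μH[1]) :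
    |∫ z in D, div2 X z| ≤ C * (μH[1] (frontier D)).toReal := by
  have hall : ∀ p : closure D, ∃ N : Set E2, IsOpen N ∧ p.1 ∈ N ∧
      ∀ φ : E2 → ℝ, ContDiff ℝ 1 φ → (∀ z, 0 ≤ φ z) → tsupport φ ⊆ N →
        HasCompactSupport φ ∧ tsupport φ ⊆ U ∧
        |∫ z in D, div2 (fun z => φ z • X z) z| ≤ C * ∫ z in frontier D, φ z ∂μH[1] := by
    rintro ⟨p, hp⟩
    have hcs : ∀ {N : Set E2} {φ : E2 → ℝ}, Bornology.IsBounded N → tsupport φ ⊆ N →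
        HasCompactSupport φ := fun hN hφ =>
      Metric.isCompact_of_isClosed_isBounded (isClosed_tsupport _) (hN.subset hφ)
    by_cases hpD : p ∈ D
    · refine ⟨D, hD, hpD, fun φ hφ hφ0 hsupp => ⟨hcs hDb hsupp,
        hsupp.trans (subset_closure.trans hDU), ?_⟩⟩
      rw [setIntegral_div2_smul_eq_zero hD hXD hφ (hcs hDb hsupp) hsupp, abs_zero]
      exact mul_nonneg hC (integral_nonneg fun z => hφ0 z)
    · obtain ⟨N, hN, hpN, h⟩ := hloc p (by rw [hD.frontier_eq]; exact ⟨hp, hpD⟩)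
      refine ⟨N ∩ U ∩ Metric.ball p 1, (hN.inter hU).inter Metric.isOpen_ball,
        ⟨⟨hpN, hDU hp⟩, Metric.mem_ball_self one_pos⟩, fun φ hφ hφ0 hsupp => ?_⟩
      have hc : HasCompactSupport φ :=
        hcs Metric.isBounded_ball (hsupp.trans Set.inter_subset_right)
      have hsU : tsupport φ ⊆ U := fun z hz => (hsupp hz).1.2
      exact ⟨hc, hsU, h φ hφ hc hφ0 hsU fun z hz => (hsupp hz).1.1⟩
  choose N hNo hpN hN using hall
  obtain ⟨t, ht⟩ := hDb.isCompact_closure.elim_finite_subcover N hNo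
    fun z hz => Set.mem_iUnion.2 ⟨⟨z, hz⟩, hpN _⟩
  obtain ⟨ρ, hρ⟩ := SmoothPartitionOfUnity.exists_isSubordinate (modelWithCornersSelf ℝ E2)
    (isClosed_closure (s := D)) (fun i : t => N i) (fun i => hNo i) (by
      intro z hz
      obtain ⟨i, hi, hzi⟩ := Set.mem_iUnion₂.1 (ht hz)
      exact Set.mem_iUnion.2 ⟨⟨i, hi⟩, hzi⟩)
  have hρ1 : ∀ i, ContDiff ℝ 1 (ρ i) := fun i =>
    (ρ i).contMDiff.contDiff.of_le (by exact_mod_cast le_top)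
  have hsum : ∀ z ∈ closure D, ∑ i, ρ i z = 1 := fun z hz => by
    rw [← finsum_eq_sum_of_fintype]
    exact ρ.sum_eq_one hz
  have hρN := fun i : t => hN i (ρ i) (hρ1 i) (fun z => ρ.nonneg i z) (hρ i)
  have hρint := fun i => integrableOn_div2_smul hD hU hXU (hXD.differentiableOn one_ne_zero) hint
    (hρ1 i) (hρN i).1 (hρN i).2.1
  have hdec : ∫ z in D, div2 X z = ∑ i, ∫ z in D, div2 (fun z => ρ i z • X z) z := by
    rw [← integral_finsetSum _ fun i _ => (hρint i).2.2.1]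
    refine setIntegral_congr_fun hD.measurableSet fun z hz => ?_
    have hd : ∀ i, DifferentiableAt ℝ (ρ i) z := fun i => (hρ1 i).differentiable one_ne_zero z
    have hXz := (hXD.differentiableOn one_ne_zero).differentiableAt (hD.mem_nhds hz)
    have hf0 : ∑ i, fderiv ℝ (ρ i) z = 0 := by
      rw [← fderiv_fun_sum fun i _ => hd i]
      have : (fun z => ∑ i, ρ i z) =ᶠ[𝓝 z] fun _ => 1 := by
        filter_upwards [hD.mem_nhds hz] with y hy using hsum y (subset_closure hy)
      rw [this.fderiv_eq, fderiv_fun_const, Pi.zero_apply]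
    rw [Finset.sum_congr rfl fun i _ => div2_smul (hd i) hXz, Finset.sum_add_distrib,
      ← Finset.sum_mul, hsum z (subset_closure hz), ← sum_apply, hf0]
    simp
  have hρF : ∀ i, IntegrableOn (ρ i) (frontier D) μH[1] := fun i => by
    obtain ⟨K, hK⟩ := (hρ1 i).continuous.bounded_above_of_compact_support (hρN i).1
    exact Measure.integrableOn_of_bounded hfin (hρ1 i).continuous.aestronglyMeasurable
      (Filter.Eventually.of_forall hK)
  calc |∫ z in D, div2 X z|
      ≤ ∑ i, |∫ z in D, div2 (fun z => ρ i z • X z) z| := by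
        rw [hdec]
        exact Finset.abs_sum_le_sum_abs _ _
    _ ≤ ∑ i, C * ∫ z in frontier D, ρ i z ∂μH[1] := Finset.sum_le_sum fun i _ => (hρN i).2.2
    _ = C * ∫ z in frontier D, ∑ i, ρ i z ∂μH[1] := by
        rw [← Finset.mul_sum, integral_finsetSum _ fun i _ => hρF i]
    _ = C * (μH[1] (frontier D)).toReal := by
        rw [setIntegral_congr_fun isClosed_frontier.measurableSet
          (fun z hz => hsum z (frontier_subset_closure hz))]
        simp [Measure.real]

/-- A planar curve with continuous velocity `(α, β)`, `α` bounded below, is a global graph. -/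
lemma exists_graph_of_velocity {α β : ℝ → ℝ} (hα : Continuous α) (hβ : Continuous β) {m δ : ℝ}
    (hm : 0 < m) (hαm : ∀ t, m ≤ α t) (hβδ : ∀ t, |β t| ≤ δ * m) (t₀ : ℝ) :
    ∃ f f' σ : ℝ → ℝ, (∀ x, HasDerivAt f (f' x) x) ∧ Continuous f' ∧ (∀ x, |f' x| ≤ δ) ∧
      Continuous σ ∧ σ 0 = t₀ ∧ (∀ x, ∫ t in t₀..σ x, α t = x) ∧
      ∀ t, f (∫ r in t₀..t, α r) = ∫ r in t₀..t, β r := by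
  set ξ : ℝ → ℝ := fun t => ∫ r in t₀..t, α r
  have hξ : ∀ t, HasDerivAt ξ (α t) t := fun t => hα.integral_hasStrictDerivAt t₀ t |>.hasDerivAt
  have hη : ∀ t, HasDerivAt (fun t => ∫ r in t₀..t, β r) (β t) t :=
    fun t => hβ.integral_hasStrictDerivAt t₀ t |>.hasDerivAt
  have hα0 : ∀ t, 0 < α t := fun t => hm.trans_le (hαm t)
  have hmono : StrictMono ξ := strictMono_of_deriv_pos fun t => by
    rw [(hξ t).deriv]
    exact hα0 t
  have hξc : Continuous ξ := continuous_of_hasDerivAt hξ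
  have hξ0 : ξ t₀ = 0 := intervalIntegral.integral_same
  have hlin : Monotone fun t => ξ t - m * t := by
    refine monotone_of_hasDerivAt_nonneg (f' := fun t => α t - m)
      (fun t => (hξ t).sub (by simpa using (hasDerivAt_id t).const_mul m)) fun t => ?_
    simpa using hαm t
  have hsurj : Function.Surjective ξ := by
    refine hξc.surjective ?_ ?_
    · have h : Filter.Tendsto (fun t : ℝ => m * t + -(m * t₀)) Filter.atTop Filter.atTop :=
        Filter.tendsto_atTop_add_const_right _ _ (Filter.tendsto_id.const_mul_atTop hm)
      refine Filter.tendsto_atTop_mono' _ ?_ h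
      filter_upwards [Filter.eventually_ge_atTop t₀] with t ht
      have := hlin ht
      simp only [hξ0] at this
      linarith
    · have h : Filter.Tendsto (fun t : ℝ => m * t + -(m * t₀)) Filter.atBot Filter.atBot :=
        Filter.tendsto_atBot_add_const_right _ _ (Filter.tendsto_id.const_mul_atBot hm)
      refine Filter.tendsto_atBot_mono' _ ?_ h
      filter_upwards [Filter.eventually_le_atBot t₀] with t ht
      have := hlin ht
      simp only [hξ0] at this
      linarith
  set o := hmono.orderIsoOfSurjective ξ hsurj
  have hoξ : ∀ t, o.symm (ξ t) = t := o.symm_apply_apply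
  have hξo : ∀ x, ξ (o.symm x) = x := o.apply_symm_apply
  have hoc : Continuous o.symm := o.symm.continuous
  have hσ : ∀ x, HasDerivAt o.symm (α (o.symm x))⁻¹ x := fun x =>
    (hξ (o.symm x)).of_local_left_inverse hoc.continuousAt (hα0 _).ne'
      (Filter.Eventually.of_forall hξo)
  refine ⟨fun x => ∫ r in t₀..o.symm x, β r, fun x => β (o.symm x) * (α (o.symm x))⁻¹, o.symm,
    fun x => (hη (o.symm x)).comp x (hσ x), ?_, fun x => ?_, hoc, ?_, hξo, fun t => ?_⟩
  · exact (hβ.comp hoc).mul ((hα.comp hoc).inv₀ fun x => (hα0 _).ne')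
  · rw [abs_mul, abs_inv, abs_of_pos (hα0 _), ← div_eq_mul_inv, div_le_iff₀ (hα0 _)]
    have hδ : 0 ≤ δ := by
      have := (abs_nonneg _).trans (hβδ 0)
      exact nonneg_of_mul_nonneg_left this hm
    exact (hβδ _).trans (mul_le_mul_of_nonneg_left (hαm _) hδ)
  · rw [← hξ0, hoξ]
  · change ∫ r in t₀..o.symm (ξ t), β r = _
    rw [hoξ]

lemma exists_orthonormalBasis_smul_eq {v : E2} (hv : v ≠ 0) :
    ∃ b : OrthonormalBasis (Fin 2) ℝ E2, v = ‖v‖ • b 0 := by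
  have hn : ‖v‖ ≠ 0 := norm_ne_zero_iff.2 hv
  have h1 : Orthonormal ℝ (({0} : Set (Fin 2)).domRestrict fun _ => ‖v‖⁻¹ • v) := by
    refine ⟨fun i => ?_, fun i j hij => (hij (Subsingleton.elim i j)).elim⟩
    change ‖‖v‖⁻¹ • v‖ = 1
    rw [norm_smul, norm_inv, norm_norm, inv_mul_cancel₀ hn]
  obtain ⟨b, hb⟩ := h1.exists_orthonormalBasis_extension_of_card_eq (by simp)
  refine ⟨b, ?_⟩
  rw [hb 0 rfl, smul_smul, mul_inv_cancel₀ hn, one_smul]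

/-- Near each of its points, a closed regular C¹ curve is a C¹ graph of small slope. -/
lemma exists_graphChart {γ : ℝ → E2} (hγ : ContDiff ℝ 1 γ) (hper : Function.Periodic γ 1)
    (hinj : Set.InjOn γ (Set.Ico (0 : ℝ) 1)) (hreg : ∀ t, deriv γ t ≠ 0) (t₀ : ℝ) {δ : ℝ}
    (hδ : 0 < δ) :
    ∃ (b : OrthonormalBasis (Fin 2) ℝ E2) (f f' : ℝ → ℝ) (a : ℝ),
      (∀ x, HasDerivAt f (f' x) x) ∧ Continuous f' ∧ (∀ x, |f' x| ≤ δ) ∧ 0 < a ∧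
      graphChart (γ t₀) b f 0 = γ t₀ ∧
      ∀ x s, |x| < a → |s| < a → (graphChart (γ t₀) b f (x, s) ∈ Set.range γ ↔ s = 0) := by
  obtain ⟨b, hb⟩ := exists_orthonormalBasis_smul_eq (hreg t₀)
  set c := ‖deriv γ t₀‖
  have hc : 0 < c := norm_pos_iff.2 (hreg t₀)
  have hd : ∀ t, HasDerivAt γ (deriv γ t) t := fun t =>
    (hγ.differentiable one_ne_zero t).hasDerivAt
  have hdc : Continuous (deriv γ) := hγ.continuous_deriv le_rfl
  have hαc : Continuous fun t => ⟪b 0, deriv γ t⟫ := by fun_prop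
  have hβc : Continuous fun t => ⟪b 1, deriv γ t⟫ := by fun_prop
  have hα0 : ⟪b 0, deriv γ t₀⟫ = c := by
    rw [hb, inner_smul_right, inner_basis_zero_zero, mul_one]
  have hβ0 : ⟪b 1, deriv γ t₀⟫ = 0 := by
    rw [hb, inner_smul_right, inner_basis_one_zero, mul_zero]
  have hev : ∀ᶠ t in 𝓝 t₀, c / 2 ≤ ⟪b 0, deriv γ t⟫ ∧ |⟪b 1, deriv γ t⟫| ≤ δ * (c / 2) := by
    refine (hαc.continuousAt.eventually (Ici_mem_nhds (by simp only [hα0]; linarith))).and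
      (hβc.abs.continuousAt.eventually (Iic_mem_nhds ?_))
    simp only [hβ0, abs_zero]
    positivity
  obtain ⟨τ', hτ', hball⟩ := Metric.nhds_basis_closedBall.mem_iff.1 hev
  set τ := min τ' (1 / 4)
  have hτ : 0 < τ := lt_min hτ' (by norm_num)
  have hτ4 : τ ≤ 1 / 4 := min_le_right _ _
  have hle : t₀ - τ ≤ t₀ + τ := by linarith
  have hκc : Continuous fun t => ((Set.projIcc (t₀ - τ) (t₀ + τ) hle t : ℝ)) :=
    continuous_subtype_val.comp continuous_projIcc
  have hκb : ∀ t, c / 2 ≤ ⟪b 0, deriv γ (Set.projIcc (t₀ - τ) (t₀ + τ) hle t)⟫ ∧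
      |⟪b 1, deriv γ (Set.projIcc (t₀ - τ) (t₀ + τ) hle t)⟫| ≤ δ * (c / 2) := fun t => by
    refine hball (Metric.closedBall_subset_closedBall (min_le_left τ' (1 / 4)) ?_)
    rw [Real.closedBall_eq_Icc]
    exact (Set.projIcc (t₀ - τ) (t₀ + τ) hle t).2
  obtain ⟨f, f', σ, hf, hf', hfδ, hσ, hσ0, hξσ, hfη⟩ := exists_graph_of_velocity
    (hαc.comp hκc) (hβc.comp hκc) (half_pos hc) (fun t => (hκb t).1) (fun t => (hκb t).2) t₀
  have hint : ∀ (i : Fin 2) t, |t - t₀| ≤ τ →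
      ∫ r in t₀..t, ⟪b i, deriv γ (Set.projIcc (t₀ - τ) (t₀ + τ) hle r)⟫ =
        ⟪b i, γ t - γ t₀⟫ := by
    intro i t ht
    have hsub : Set.uIcc t₀ t ⊆ Set.Icc (t₀ - τ) (t₀ + τ) :=
      Set.uIcc_subset_Icc ⟨by linarith, by linarith⟩
        ⟨by linarith [(abs_le.1 ht).1], by linarith [(abs_le.1 ht).2]⟩
    have hdi : ∀ r, HasDerivAt (fun r => ⟪b i, γ r⟫) ⟪b i, deriv γ r⟫ r := fun r =>
      (innerSL ℝ (b i)).hasFDerivAt.comp_hasDerivAt r (hd r)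
    rw [intervalIntegral.integral_congr (g := fun r => ⟪b i, deriv γ r⟫) fun r hr => by
        simp only [Set.projIcc_of_mem hle (hsub hr)],
      intervalIntegral.integral_eq_sub_of_hasDerivAt (fun r _ => hdi r)
        ((by fun_prop : Continuous fun r => ⟪b i, deriv γ r⟫).intervalIntegrable _ _),
      inner_sub_right]
  have hcurve : ∀ t, |t - t₀| ≤ τ →
      γ t = graphChart (γ t₀) b f
        (∫ r in t₀..t, ⟪b 0, deriv γ (Set.projIcc (t₀ - τ) (t₀ + τ) hle r)⟫, 0) := by
    intro t ht
    have h := graphChart_coords (γ t₀) b f (γ t)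
    have h1 := hfη t
    simp only [Function.comp_def] at h1
    rw [hint 0 t ht, hint 1 t ht] at h1
    rw [hint 0 t ht, ← sub_self (f ⟪b 0, γ t - γ t₀⟫)]
    conv_rhs => rw [show f ⟪b 0, γ t - γ t₀⟫ - f ⟪b 0, γ t - γ t₀⟫ =
      ⟪b 1, γ t - γ t₀⟫ - f ⟪b 0, γ t - γ t₀⟫ by rw [h1]]
    exact h.symm
  have hp : graphChart (γ t₀) b f 0 = γ t₀ := by
    have h := hcurve t₀ (by simpa using hτ.le)
    rw [intervalIntegral.integral_same] at h
    exact h.symm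
  have hfract : ∀ t, γ (Int.fract t) = γ t := fun t => by
    rw [Int.fract]
    simpa using hper.sub_int_mul_eq (x := t) ⌊t⌋
  have hK : γ t₀ ∉ γ '' Set.Icc (t₀ + τ) (t₀ + 1 - τ) := by
    rintro ⟨t, ht, htt⟩
    rw [← hfract t, ← hfract t₀] at htt
    have h := hinj ⟨Int.fract_nonneg _, Int.fract_lt_one _⟩
      ⟨Int.fract_nonneg _, Int.fract_lt_one _⟩ htt
    obtain ⟨z, hz⟩ := Int.fract_eq_fract.1 h
    have h0 : (0 : ℝ) < z := by linarith [ht.1]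
    have h1 : (z : ℝ) < 1 := by linarith [ht.2]
    have h0' : 0 < z := by exact_mod_cast h0
    have h1' : z < 1 := by exact_mod_cast h1
    omega
  have hΨ := continuous_graphChart (γ t₀) b (continuous_of_hasDerivAt hf)
  have hnhds : ∀ᶠ w : ℝ × ℝ in 𝓝 0,
      graphChart (γ t₀) b f w ∉ γ '' Set.Icc (t₀ + τ) (t₀ + 1 - τ) ∧ |σ w.1 - t₀| < τ := by
    refine (hΨ.continuousAt.eventually
      ((isCompact_Icc.image hγ.continuous).isClosed.isOpen_compl.mem_nhds ?_)).and
      ((by fun_prop : Continuous fun w : ℝ × ℝ => |σ w.1 - t₀|).continuousAt.eventually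
        (Iio_mem_nhds ?_))
    · rw [hp]
      exact hK
    · simpa [hσ0] using hτ
  obtain ⟨a, ha, hbox⟩ := Metric.nhds_basis_ball.mem_iff.1 hnhds
  refine ⟨b, f, f', a, hf, hf', hfδ, ha, hp, fun x s hx hs => ?_⟩
  obtain ⟨h1, h2⟩ := hbox (show (x, s) ∈ Metric.ball (0 : ℝ × ℝ) a by
    rw [mem_ball_zero_iff, Prod.norm_def]
    exact max_lt hx hs)
  constructor
  · rintro ⟨r, hr⟩
    obtain ⟨t, ht, htr⟩ := hper.exists_mem_Ico one_pos r (t₀ - τ)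
    rw [htr] at hr
    by_cases htτ : t ≤ t₀ + τ
    · rw [hcurve t (abs_le.2 ⟨by linarith [ht.1], by linarith⟩)] at hr
      exact (congrArg Prod.snd (graphChart_injective _ _ _ hr)).symm
    · exact (h1 ⟨t, ⟨by linarith, by linarith [ht.2]⟩, hr⟩).elim
  · rintro rfl
    refine ⟨σ x, ?_⟩
    rw [hcurve _ h2.le]
    exact congrArg (fun y => graphChart (γ t₀) b f (y, 0)) (hξσ x)

lemma hausdorffMeasure_range_lt_top {γ : ℝ → E2} (hγ : ContDiff ℝ 1 γ)
    (hper : Function.Periodic γ 1) : μH[1] (Set.range γ) < ⊤ := by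
  obtain ⟨K, hK⟩ := hγ.contDiffOn.exists_lipschitzOnWith (s := Set.Icc (0 : ℝ) 1) one_ne_zero
    (convex_Icc 0 1) isCompact_Icc
  have h := hK.hausdorffMeasure_image_le zero_le_one
  have himg : γ '' Set.Icc 0 1 = Set.range γ := by
    simpa using hper.image_Icc one_pos 0
  rw [himg, hausdorffMeasure_real] at h
  refine h.trans_lt ?_
  simp

lemma hausdorffMeasure_range_pos {γ : ℝ → E2} (hγ : Continuous γ) {s t : ℝ} (h : γ s ≠ γ t) :
    0 < μH[1] (Set.range γ) := by
  have hlip : LipschitzWith 1 fun z => dist z (γ s) := LipschitzWith.dist_left (γ s)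
  have h1 := hlip.hausdorffMeasure_image_le zero_le_one (Set.range γ)
  have hsub : Set.Icc 0 (dist (γ t) (γ s)) ⊆ (fun z => dist z (γ s)) '' Set.range γ := by
    have hc : IsPreconnected ((fun z => dist z (γ s)) '' Set.range γ) :=
      (isPreconnected_range hγ).image _ hlip.continuous.continuousOn
    refine hc.Icc_subset ⟨γ s, ⟨s, rfl⟩, dist_self _⟩ ⟨γ t, ⟨t, rfl⟩, rfl⟩
  have h2 := measure_mono (μ := (volume : Measure ℝ)) hsub
  rw [hausdorffMeasure_real] at h1
  rw [Real.volume_Icc, sub_zero] at h2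
  refine (ENNReal.ofReal_pos.2 (dist_pos.2 h.symm)).trans_le (h2.trans (h1.trans ?_))
  simp

lemma continuousOn_gradient {u : E2 → ℝ} {U : Set E2} (hU : IsOpen U) (hu : ContDiffOn ℝ 1 u U) :
    ContinuousOn (gradient u) U :=
  (InnerProductSpace.toDual ℝ E2).symm.continuous.comp_continuousOn
    (hu.continuousOn_fderiv_of_isOpen hU le_rfl)

lemma contDiffOn_gradient {u : E2 → ℝ} {D : Set E2} (hD : IsOpen D) (hu : ContDiffOn ℝ 2 u D) :
    ContDiffOn ℝ 1 (gradient u) D :=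
  (InnerProductSpace.toDual ℝ E2).symm.contDiff.comp_contDiffOn
    (hu.fderiv_of_isOpen hD (by norm_num))

lemma one_le_W (u : E2 → ℝ) (x : E2) : 1 ≤ W u x :=
  Real.one_le_sqrt.2 (by linarith [sq_nonneg ‖gradient u x‖])

lemma W_pos (u : E2 → ℝ) (x : E2) : 0 < W u x := one_pos.trans_le (one_le_W u x)

lemma continuousOn_W {u : E2 → ℝ} {U : Set E2} (hu : ContinuousOn (gradient u) U) :
    ContinuousOn (W u) U :=
  Real.continuous_sqrt.comp_continuousOn (continuousOn_const.add (hu.norm.pow 2))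

lemma contDiffOn_W {u : E2 → ℝ} {D : Set E2} (hu : ContDiffOn ℝ 1 (gradient u) D) :
    ContDiffOn ℝ 1 (W u) D :=
  (contDiffOn_const.add (hu.norm_sq ℝ)).sqrt fun x _ => by positivity

lemma norm_inv_W_smul_gradient_lt_one (u : E2 → ℝ) (x : E2) :
    ‖(W u x)⁻¹ • gradient u x‖ < 1 := by
  rw [norm_smul, norm_inv, Real.norm_of_nonneg (W_pos u x).le, inv_mul_lt_one₀ (W_pos u x)]
  exact Real.lt_sqrt_of_sq_lt (by linarith)

lemma isOpen_graphChart_image {p : E2} {b : OrthonormalBasis (Fin 2) ℝ E2} {f : ℝ → ℝ}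
    (hf : Continuous f) {s : Set (ℝ × ℝ)} (hs : IsOpen s) : IsOpen (graphChart p b f '' s) := by
  have h : graphChart p b f '' s =
      (fun z => (⟪b 0, z - p⟫, ⟪b 1, z - p⟫ - f ⟪b 0, z - p⟫)) ⁻¹' s := by
    ext z
    constructor
    · rintro ⟨w, hw, rfl⟩
      rw [Set.mem_preimage, inner_basis_zero_graphChart_sub, inner_basis_one_graphChart_sub,
        add_sub_cancel_left]
      exact hw
    · exact fun hz => ⟨_, hz, graphChart_coords p b f z⟩
  rw [h]
  exact hs.preimage (by fun_prop)

/-- On a bounded domain bounded by a C¹ curve, the integral of the divergence of a field of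
norm less than one is less than the length of the boundary. -/
lemma abs_integral_div2_lt_hausdorffMeasure_frontier {D U : Set E2} {X : E2 → E2}
    (hD : IsOpen D) (hDb : Bornology.IsBounded D)
    (hcurve : IsC1ClosedCurve (frontier D)) (hU : IsOpen U) (hDU : closure D ⊆ U)
    (hXU : ContinuousOn X U) (hXD : ContDiffOn ℝ 1 X D) (hint : IntegrableOn (div2 X) D)
    (hX : ∀ z ∈ frontier D, ‖X z‖ < 1) :
    |∫ z in D, div2 X z| < (μH[1] (frontier D)).toReal := by
  obtain ⟨γ, hγ, hper, hinj, hreg, hrange⟩ := hcurve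
  have hfin : μH[1] (frontier D) < ⊤ := hrange ▸ hausdorffMeasure_range_lt_top hγ hper
  have hpos : 0 < μH[1] (frontier D) := by
    rw [← hrange]
    refine hausdorffMeasure_range_pos hγ.continuous (s := 0) (t := 1 / 2) fun h => ?_
    have := hinj (by norm_num) (by norm_num) h
    norm_num at this
  obtain ⟨q, hq0, hq1, hq⟩ : ∃ q : ℝ, 0 ≤ q ∧ q < 1 ∧ ∀ z ∈ frontier D, ‖X z‖ ≤ q := by
    have hcpt : IsCompact (frontier D) :=
      hDb.isCompact_closure.of_isClosed_subset isClosed_frontier frontier_subset_closure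
    obtain ⟨z₀, hz₀, hmax⟩ := hcpt.exists_isMaxOn ⟨γ 0, hrange ▸ Set.mem_range_self 0⟩
      (hXU.mono (frontier_subset_closure.trans hDU)).norm
    exact ⟨‖X z₀‖, norm_nonneg _, hX z₀ hz₀, fun z hz => hmax hz⟩
  have hδ : 0 < (1 - q) / 2 := by linarith
  have hC : 0 ≤ (1 + (1 - q) / 2) * q := by positivity
  have hle := abs_integral_div2_le_of_local hD hDb hU hDU hXU hXD hint hfin.ne hC fun p hp => by
    obtain ⟨t₀, rfl⟩ : p ∈ Set.range γ := hrange ▸ hp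
    obtain ⟨b, f, f', a, hf, hf', hfδ, ha, h0, hFr⟩ := exists_graphChart hγ hper hinj hreg t₀ hδ
    refine ⟨graphChart (γ t₀) b f '' (Set.Ioo (-a) a ×ˢ Set.Ioo (-a) a),
      isOpen_graphChart_image (continuous_of_hasDerivAt hf) (isOpen_Ioo.prod isOpen_Ioo),
      ⟨0, ⟨by simpa using ha, by simpa using ha⟩, h0⟩, fun φ hφ hφc hφ0 hsuppU hsupp => ?_⟩
    exact abs_integral_div2_smul_le hf hf' hfδ hD hU hXU hXD hint hq0 hq hfin.ne ha
      (hrange ▸ hFr) hφ hφc hφ0 hsuppU hsupp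
  have hlen : 0 < (μH[1] (frontier D)).toReal := ENNReal.toReal_pos hpos.ne' hfin.ne
  have hC1 : (1 + (1 - q) / 2) * q < 1 := by nlinarith
  exact hle.trans_lt (mul_lt_of_lt_one_left hlen hC1)

/-- Flux inequality; graph form of the necessary condition on λ. -/
theorem flux_inequality
    (D : Set E2) (hD : D.Nonempty) (hDopen : IsOpen D) (hDbdd : Bornology.IsBounded D)
    (hbdry : IsC1ClosedCurve (frontier D))
    (lam : ℝ) (u : E2 → ℝ)
    (hreg : ∃ U : Set E2, IsOpen U ∧ closure D ⊆ U ∧ ContDiffOn ℝ 1 u U)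
    (hsol : SatisfiesSolitonEq lam D u) :
    |2 * lam * (volume D).toReal + ∫ x in D, (Real.sqrt (1 + ‖gradient u x‖ ^ 2))⁻¹|
      < (μH[1] (frontier D)).toReal := by
  obtain ⟨U, hU, hDU, huU⟩ := hreg
  obtain ⟨huD, hdiv⟩ := hsol
  have hgU := continuousOn_gradient hU huU
  have hgD := contDiffOn_gradient hDopen huD
  have hWinv : ContinuousOn (fun x => (W u x)⁻¹) U :=
    (continuousOn_W hgU).inv₀ fun x _ => (W_pos u x).ne'
  have hWint : IntegrableOn (fun x => (W u x)⁻¹) D :=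
    ((hWinv.mono hDU).integrableOn_compact hDbdd.isCompact_closure).mono_set subset_closure
  have hcint : IntegrableOn (fun _ : E2 => 2 * lam) D :=
    integrableOn_const hDbdd.measure_lt_top.ne
  have hdivint : IntegrableOn (div2 fun y => (W u y)⁻¹ • gradient u y) D :=
    (hcint.add hWint).congr_fun (fun x hx => (hdiv x hx).symm) hDopen.measurableSet
  have hval : ∫ x in D, div2 (fun y => (W u y)⁻¹ • gradient u y) x =
      2 * lam * (volume D).toReal + ∫ x in D, (Real.sqrt (1 + ‖gradient u x‖ ^ 2))⁻¹ := by
    rw [setIntegral_congr_fun hDopen.measurableSet hdiv, integral_add hcint hWint,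
      setIntegral_const, smul_eq_mul, mul_comm, measureReal_def]
    rfl
  rw [← hval]
  exact abs_integral_div2_lt_hausdorffMeasure_frontier hDopen hDbdd hbdry hU hDU
    (hWinv.smul hgU)
    (((contDiffOn_W hgD).inv fun x _ => (W_pos u x).ne').smul hgD) hdivint
    fun z _ => norm_inv_W_smul_gradient_lt_one u z
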